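/- Let s ≥ 1 and f ∈ C^s[0,1] satisfy f(0), f(1), f'(0), f'(1) ∈ ℤ and f^(i)(0) = f^(i)(1) = 0 for i = 2,…,s. Then there is a constant c = c(s) such that for all n ≥ s, sup_{x∈[0,1]} |(B_n f)^(s)(x) − (B̂_n(f))^(s)(x)| ≤ c (ω₁(f^(s), 1/n) + 1/n). -/

import Mathlib

open Finset

/-- The modulus of continuity of `F` on `[0,1]`. -/
noncomputable def omega1 (F : ℝ → ℝ) (t : ℝ) : ℝ :=
  sSup {d : ℝ | ∃ x ∈ Set.Icc (0:ℝ) 1, ∃ y ∈ Set.Icc (0:ℝ) 1, |x - y| ≤ t ∧ d = |F x - F y|}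

open Polynomial in
/-- The polynomial of degree at most `n` with coefficients `d` in the Bernstein basis. -/
noncomputable def bernsteinSum (n : ℕ) (d : ℕ → ℝ) : ℝ[X] :=
  ∑ k ∈ range (n + 1), C (d k) * bernsteinPolynomial ℝ n k

theorem eval_bernsteinSum (n : ℕ) (d : ℕ → ℝ) (x : ℝ) :
    (bernsteinSum n d).eval x =
      ∑ k ∈ range (n + 1), d k * (n.choose k : ℝ) * x ^ k * (1 - x) ^ (n - k) := by
  simp [bernsteinSum, bernsteinPolynomial, Polynomial.eval_finsetSum, mul_assoc]

theorem bernsteinSum_sub (n : ℕ) (d e : ℕ → ℝ) :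
    bernsteinSum n d - bernsteinSum n e = bernsteinSum n (fun k => d k - e k) := by
  simp [bernsteinSum, sub_mul, sum_sub_distrib]

theorem derivative_bernsteinSum_succ (n : ℕ) (d : ℕ → ℝ) :
    (bernsteinSum (n + 1) d).derivative =
      bernsteinSum n (fun k => (n + 1) * (d (k + 1) - d k)) := by
  have key : ∑ k ∈ range (n + 1), Polynomial.C (d (k + 1)) * bernsteinPolynomial ℝ n (k + 1)
      + Polynomial.C (d 0) * bernsteinPolynomial ℝ n 0
      = ∑ k ∈ range (n + 1), Polynomial.C (d k) * bernsteinPolynomial ℝ n k := by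
    rw [← sum_range_succ' (fun k => Polynomial.C (d k) * bernsteinPolynomial ℝ n k), sum_range_succ,
      bernsteinPolynomial.eq_zero_of_lt ℝ (Nat.lt_succ_self n), mul_zero, add_zero]
  have lhs : (bernsteinSum (n + 1) d).derivative = (n + 1) *
      (∑ k ∈ range (n + 1), Polynomial.C (d (k + 1)) * bernsteinPolynomial ℝ n k
      - (∑ k ∈ range (n + 1), Polynomial.C (d (k + 1)) * bernsteinPolynomial ℝ n (k + 1)
      + Polynomial.C (d 0) * bernsteinPolynomial ℝ n 0)) := by
    rw [bernsteinSum, sum_range_succ', Polynomial.derivative_add, Polynomial.derivative_sum,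
      ← sub_sub, ← sum_sub_distrib, mul_sub, mul_sum]
    simp only [Polynomial.derivative_C_mul, bernsteinPolynomial.derivative_succ,
      bernsteinPolynomial.derivative_zero, Nat.add_sub_cancel]
    rw [sub_eq_add_neg]
    congr 1
    · refine sum_congr rfl fun k _ => ?_
      push_cast
      ring
    · push_cast
      ring
  rw [lhs, key, ← sum_sub_distrib, mul_sum, bernsteinSum]
  refine sum_congr rfl fun k _ => ?_
  simp only [Polynomial.C_mul, Polynomial.C_sub, Polynomial.C_add, Polynomial.C_1, map_natCast]
  ring

theorem abs_eval_bernsteinSum_le {n : ℕ} {d : ℕ → ℝ} {M x : ℝ}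
    (hd : ∀ k ≤ n, |d k| ≤ M) (hx : x ∈ Set.Icc (0 : ℝ) 1) :
    |(bernsteinSum n d).eval x| ≤ M := by
  have hone := congrArg (Polynomial.eval x) (bernsteinPolynomial.sum ℝ n)
  rw [Polynomial.eval_finsetSum, Polynomial.eval_one] at hone
  have hnonneg : ∀ k, 0 ≤ (bernsteinPolynomial ℝ n k).eval x := fun k => by
    have h0 := hx.1
    have h1 := sub_nonneg.2 hx.2
    simp only [bernsteinPolynomial, Polynomial.eval_mul, Polynomial.eval_natCast,
      Polynomial.eval_pow, Polynomial.eval_X, Polynomial.eval_sub, Polynomial.eval_one]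
    positivity
  rw [bernsteinSum, Polynomial.eval_finsetSum]
  calc |∑ k ∈ range (n + 1), (Polynomial.C (d k) * bernsteinPolynomial ℝ n k).eval x|
      ≤ ∑ k ∈ range (n + 1), M * (bernsteinPolynomial ℝ n k).eval x := by
        refine (abs_sum_le_sum_abs _ _).trans (sum_le_sum fun k hk => ?_)
        rw [Polynomial.eval_mul, Polynomial.eval_C, abs_mul, abs_of_nonneg (hnonneg k)]
        exact mul_le_mul_of_nonneg_right (hd k (mem_range_succ_iff.1 hk)) (hnonneg k)
    _ = M := by rw [← mul_sum, hone, mul_one]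

theorem abs_eval_iterate_derivative_bernsteinSum_le (s : ℕ) {n : ℕ} {d : ℕ → ℝ} {M x : ℝ}
    (hd : ∀ k ≤ n, |d k| ≤ M) (hx : x ∈ Set.Icc (0 : ℝ) 1) :
    |(Polynomial.derivative^[s] (bernsteinSum n d)).eval x| ≤ (2 * n) ^ s * M := by
  have hM : 0 ≤ M := (abs_nonneg _).trans (hd 0 n.zero_le)
  induction s generalizing n d M with
  | zero => simpa using abs_eval_bernsteinSum_le hd hx
  | succ s ih =>
    rw [Function.iterate_succ_apply]
    cases n with
    | zero =>
      have : (bernsteinSum 0 d).derivative = 0 := by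
        simp [bernsteinSum, bernsteinPolynomial]
      rw [this, Polynomial.iterate_derivative_zero]
      simp
    | succ m =>
      rw [derivative_bernsteinSum_succ]
      have hd' : ∀ k ≤ m, |((m : ℝ) + 1) * (d (k + 1) - d k)| ≤ ((m : ℝ) + 1) * (2 * M) := by
        intro k hk
        rw [abs_mul, abs_of_nonneg (by positivity : (0 : ℝ) ≤ m + 1)]
        refine mul_le_mul_of_nonneg_left ?_ (by positivity)
        linarith [abs_sub (d (k + 1)) (d k), hd (k + 1) (by omega), hd k (by omega)]
      refine (ih hd' (by positivity)).trans ?_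
      push_cast
      calc (2 * (m : ℝ)) ^ s * ((m + 1) * (2 * M))
          ≤ (2 * ((m : ℝ) + 1)) ^ s * ((m + 1) * (2 * M)) := by gcongr; linarith
        _ = (2 * ((m : ℝ) + 1)) ^ (s + 1) * M := by ring

theorem Polynomial.iteratedDeriv_eval (p : Polynomial ℝ) (s : ℕ) :
    iteratedDeriv s (fun x => p.eval x) = fun x => (Polynomial.derivative^[s] p).eval x := by
  induction s with
  | zero => simp
  | succ s ih =>
    ext x
    rw [iteratedDeriv_succ, ih, Polynomial.deriv, Function.iterate_succ_apply']

theorem Nat.choose_le_choose_of_le_of_le_sub {n r k : ℕ} (hrk : r ≤ k) (hk : k ≤ n)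
    (hrn : r ≤ n - k) : n.choose r ≤ n.choose k := by
  have half : ∀ m, r ≤ m → m ≤ n / 2 → n.choose r ≤ n.choose m := by
    intro m hm
    induction m, hm using Nat.le_induction with
    | base => exact fun _ => le_rfl
    | succ m _ ih =>
      exact fun h => (ih (by omega)).trans (Nat.choose_le_succ_of_lt_half_left (by omega))
  by_cases h : k ≤ n / 2
  · exact half k hrk h
  · rw [← Nat.choose_symm hk]
    exact half (n - k) hrn (by omega)

theorem inv_choose_le {s n k : ℕ} (hk : s < k) (hkn : s < n - k) :
    1 / (n.choose k : ℝ) ≤ 2 ^ (s + 1) * (s + 1).factorial / (n : ℝ) ^ (s + 1) := by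
  have hn : (0 : ℝ) < n := by exact_mod_cast (by omega : 0 < n)
  have h1 : (n.choose (s + 1) : ℝ) ≤ n.choose k := by
    exact_mod_cast Nat.choose_le_choose_of_le_of_le_sub hk (by omega) hkn
  have h2 := Nat.pow_le_choose (α := ℝ) (s + 1) n
  have h3 : (n : ℝ) / 2 ≤ ((n + 1 - (s + 1) : ℕ) : ℝ) := by
    rw [div_le_iff₀ two_pos]
    exact_mod_cast (by omega : n ≤ (n + 1 - (s + 1)) * 2)
  have h4 : ((n : ℝ) / 2) ^ (s + 1) / (s + 1).factorial ≤ n.choose k := by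
    refine le_trans ?_ (h2.trans h1)
    gcongr
  calc 1 / (n.choose k : ℝ) ≤ 1 / (((n : ℝ) / 2) ^ (s + 1) / (s + 1).factorial) :=
        one_div_le_one_div_of_le (by positivity) h4
    _ = 2 ^ (s + 1) * (s + 1).factorial / (n : ℝ) ^ (s + 1) := by
        rw [div_pow]
        field_simp

theorem exists_int_choose_mul_div (n j : ℕ) (hn : 0 < n) :
    ∃ m : ℤ, (n.choose j : ℝ) * (j / n) = m := by
  obtain ⟨n, rfl⟩ := Nat.exists_eq_add_of_lt hn
  cases j with
  | zero => exact ⟨0, by simp⟩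
  | succ j =>
    refine ⟨(n.choose j : ℕ), ?_⟩
    have h : ((n : ℝ) + 1) * n.choose j = (n + 1).choose (j + 1) * (j + 1) := by
      exact_mod_cast Nat.add_one_mul_choose_eq n j
    have hn' : (n : ℝ) + 1 ≠ 0 := by positivity
    rw [Nat.zero_add]
    push_cast
    field_simp
    linarith

theorem abs_sub_nint_le {nint : ℝ → ℤ} (hnint : ∀ a : ℝ, |a - (nint a : ℝ)| ≤ 1 / 2)
    (a : ℝ) (m : ℤ) : |a - nint a| ≤ |a - m| := by
  by_cases h : nint a = m
  · rw [h]
  · have h1 : (1 : ℝ) ≤ |(nint a : ℝ) - m| := by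
      exact_mod_cast Int.one_le_abs (sub_ne_zero.2 h)
    have h2 : |(nint a : ℝ) - m| ≤ |a - nint a| + |a - m| := by
      rw [abs_sub_comm a (nint a : ℝ)]
      exact abs_sub_le _ _ _
    linarith [hnint a]

theorem abs_sub_le_omega1 {F : ℝ → ℝ} (hF : ContinuousOn F (Set.Icc 0 1)) {t x y : ℝ}
    (hx : x ∈ Set.Icc (0 : ℝ) 1) (hy : y ∈ Set.Icc (0 : ℝ) 1) (hxy : |x - y| ≤ t) :
    |F x - F y| ≤ omega1 F t := by
  obtain ⟨B, hB⟩ := isCompact_Icc.exists_bound_of_continuousOn hF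
  refine le_csSup ⟨B + B, ?_⟩ ⟨x, hx, y, hy, hxy, rfl⟩
  rintro _ ⟨u, hu, v, hv, -, rfl⟩
  have h1 := hB u hu
  have h2 := hB v hv
  rw [Real.norm_eq_abs] at h1 h2
  linarith [abs_sub (F u) (F v)]

theorem omega1_nonneg (F : ℝ → ℝ) (t : ℝ) : 0 ≤ omega1 F t := by
  apply Real.sSup_nonneg
  rintro _ ⟨u, -, v, -, -, rfl⟩
  exact abs_nonneg _

theorem abs_sub_le_nat_mul_omega1 {F : ℝ → ℝ} (hF : ContinuousOn F (Set.Icc 0 1)) {t a u : ℝ}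
    (ha : a ∈ Set.Icc (0 : ℝ) 1) (hu : u ∈ Set.Icc (0 : ℝ) 1) (k : ℕ) (hua : |u - a| ≤ k * t) :
    |F u - F a| ≤ k * omega1 F t := by
  induction k generalizing u with
  | zero =>
    have : u - a = 0 := by simpa using hua
    simp [sub_eq_zero.1 this]
  | succ k ih =>
    have hk : (0 : ℝ) < k + 1 := by positivity
    push_cast at hua ⊢
    set w : ℝ := 1 / (k + 1) with hw
    have hw0 : 0 ≤ w := by positivity
    have hwk : w * (k + 1) = 1 := by rw [hw]; field_simp
    have hw1 : 0 ≤ 1 - w := by nlinarith [(Nat.cast_nonneg k : (0 : ℝ) ≤ k)]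
    have hv : w * a + (1 - w) * u ∈ Set.Icc (0 : ℝ) 1 :=
      (convex_Icc (0 : ℝ) 1) ha hu hw0 hw1 (by ring)
    have hscale : w * |u - a| ≤ t := by
      calc w * |u - a| ≤ w * ((k + 1) * t) := by gcongr
        _ = t := by rw [← mul_assoc, hwk, one_mul]
    have h1 : |u - (w * a + (1 - w) * u)| ≤ t := by
      rw [show u - (w * a + (1 - w) * u) = w * (u - a) by ring, abs_mul, abs_of_nonneg hw0]
      exact hscale
    have h2 : |(w * a + (1 - w) * u) - a| ≤ k * t := by
      rw [show (w * a + (1 - w) * u) - a = (1 - w) * (u - a) by ring, abs_mul,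
        abs_of_nonneg hw1, show 1 - w = k * w by linarith, mul_assoc]
      gcongr
    have := abs_sub_le (F u) (F (w * a + (1 - w) * u)) (F a)
    linarith [abs_sub_le_omega1 hF hu hv h1, ih hv h2]

/-- One integration step: a bound on the derivative between `a` and `t` bounds the increment. -/
theorem abs_sub_le_of_abs_derivWithin_le {g : ℝ → ℝ} {a t K : ℝ} {S : Set ℝ} (hS : Convex ℝ S)
    (hg : DifferentiableOn ℝ g S) (ha : a ∈ S) (ht : t ∈ S) (L : ℝ)
    (hb : ∀ u ∈ S, |u - a| ≤ |t - a| → |derivWithin g S u - L| ≤ K) :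
    |g t - g a - L * (t - a)| ≤ K * |t - a| := by
  have hsub : segment ℝ a t ⊆ S := hS.segment_subset ha ht
  have hder : ∀ u ∈ segment ℝ a t, HasDerivWithinAt (fun u => g u - L * u)
      (derivWithin g S u - L) (segment ℝ a t) u := fun u hu => by
    have h := ((hg u (hsub hu)).hasDerivWithinAt.mono hsub).sub
      ((hasDerivWithinAt_id u (segment ℝ a t)).const_mul L)
    rw [mul_one] at h
    exact h
  have hbound : ∀ u ∈ segment ℝ a t, ‖derivWithin g S u - L‖ ≤ K := fun u hu => by
    refine hb u (hsub hu) ?_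
    rw [segment_eq_uIcc] at hu
    exact Set.abs_sub_left_of_mem_uIcc hu
  have h := (convex_segment a t).norm_image_sub_le_of_norm_hasDerivWithin_le hder hbound
    (left_mem_segment ℝ a t) (right_mem_segment ℝ a t)
  rw [Real.norm_eq_abs, Real.norm_eq_abs] at h
  calc |g t - g a - L * (t - a)| = |g t - L * t - (g a - L * a)| := by congr 1; ring
    _ ≤ K * |t - a| := h

theorem abs_sub_linear_le {s : ℕ} (hs : 1 ≤ s) {f : ℝ → ℝ}
    (hf : ContDiffOn ℝ s f (Set.Icc (0 : ℝ) 1)) {a t K : ℝ}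
    (ha : a ∈ Set.Icc (0 : ℝ) 1) (ht : t ∈ Set.Icc (0 : ℝ) 1)
    (hzero : ∀ i : ℕ, 2 ≤ i → i ≤ s → iteratedDerivWithin i f (Set.Icc (0 : ℝ) 1) a = 0)
    (hK : ∀ u ∈ Set.Icc (0 : ℝ) 1, |u - a| ≤ |t - a| →
      |iteratedDerivWithin s f (Set.Icc (0 : ℝ) 1) u
        - iteratedDerivWithin s f (Set.Icc (0 : ℝ) 1) a| ≤ K) :
    |f t - f a - derivWithin f (Set.Icc (0 : ℝ) 1) a * (t - a)| ≤ K * |t - a| ^ s := by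
  have hK0 : 0 ≤ K := (abs_nonneg _).trans (hK a ha (by simp))
  have huniq : UniqueDiffOn ℝ (Set.Icc (0 : ℝ) 1) := uniqueDiffOn_Icc zero_lt_one
  have hconv : Convex ℝ (Set.Icc (0 : ℝ) 1) := convex_Icc 0 1
  have hdiff : ∀ j < s, DifferentiableOn ℝ (iteratedDerivWithin j f (Set.Icc (0 : ℝ) 1))
      (Set.Icc 0 1) := fun j hj =>
    hf.differentiableOn_iteratedDerivWithin (by exact_mod_cast hj) huniq
  have main : ∀ j, j + 1 ≤ s → ∀ u ∈ Set.Icc (0 : ℝ) 1, |u - a| ≤ |t - a| →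
      |iteratedDerivWithin (s - j) f (Set.Icc (0 : ℝ) 1) u
        - iteratedDerivWithin (s - j) f (Set.Icc (0 : ℝ) 1) a| ≤ K * |t - a| ^ j := by
    intro j
    induction j with
    | zero => intro _ u hu hut; simpa using hK u hu hut
    | succ j ih =>
      intro hj u hu hut
      have hsucc : s - j = s - (j + 1) + 1 := by omega
      have hz := hzero (s - j) (by omega) (by omega)
      have h := abs_sub_le_of_abs_derivWithin_le (K := K * |t - a| ^ j) hconv
        (hdiff (s - (j + 1)) (by omega)) ha hu 0 (by
          intro v hv hvu
          have := ih (by omega) v hv (hvu.trans hut)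
          rw [hz, hsucc, iteratedDerivWithin_succ] at this
          exact this)
      rw [zero_mul, sub_zero] at h
      refine h.trans ?_
      rw [pow_succ, ← mul_assoc]
      gcongr
  have h := abs_sub_le_of_abs_derivWithin_le (K := K * |t - a| ^ (s - 1)) hconv
    (hf.differentiableOn (by exact_mod_cast (by omega : s ≠ 0))) ha ht
    (derivWithin f (Set.Icc (0 : ℝ) 1) a) (by
      intro u hu hut
      have := main (s - 1) (by omega) u hu hut
      rwa [show s - (s - 1) = 1 by omega, iteratedDerivWithin_one] at this)
  rwa [mul_assoc, ← pow_succ, Nat.sub_add_cancel hs] at h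

/-- Rounding `f t * C(n, j)` costs little when `t` lies within `j / n` of an endpoint `a`,
`j ≤ s`. -/
theorem abs_round_sub_le_near_endpoint {s : ℕ} (hs : 1 ≤ s) {nint : ℝ → ℤ}
    (hnint : ∀ a : ℝ, |a - (nint a : ℝ)| ≤ 1 / 2) {f : ℝ → ℝ}
    (hf : ContDiffOn ℝ s f (Set.Icc (0 : ℝ) 1)) {a t : ℝ}
    (ha : a ∈ Set.Icc (0 : ℝ) 1) (ht : t ∈ Set.Icc (0 : ℝ) 1)
    (hfa : ∃ m : ℤ, f a = m) (hfa' : ∃ m : ℤ, derivWithin f (Set.Icc (0 : ℝ) 1) a = m)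
    (hzero : ∀ i : ℕ, 2 ≤ i → i ≤ s → iteratedDerivWithin i f (Set.Icc (0 : ℝ) 1) a = 0)
    {n j : ℕ} (hn : 0 < n) (hjs : j ≤ s)
    (hta : t - a = j / n ∨ t - a = -(j / n)) :
    |f t * (n.choose j : ℝ) - nint (f t * (n.choose j : ℝ))| ≤
      n.choose j * (s ^ (s + 1) *
        omega1 (iteratedDerivWithin s f (Set.Icc (0 : ℝ) 1)) (1 / n) / n ^ s) := by
  set F := iteratedDerivWithin s f (Set.Icc (0 : ℝ) 1) with hFdef
  have hF : ContinuousOn F (Set.Icc 0 1) :=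
    hf.continuousOn_iteratedDerivWithin le_rfl (uniqueDiffOn_Icc zero_lt_one)
  have hω := omega1_nonneg F (1 / n)
  have habs : |t - a| = j / n := by
    have : (0 : ℝ) ≤ j / n := by positivity
    rcases hta with h | h
    · rw [h, abs_of_nonneg this]
    · rw [h, abs_neg, abs_of_nonneg this]
  have hjs' : (j : ℝ) ≤ s := by exact_mod_cast hjs
  have hlin := abs_sub_linear_le hs hf ha ht hzero (K := s * omega1 F (1 / n)) (by
    intro u hu hut
    refine (abs_sub_le_nat_mul_omega1 (t := 1 / n) hF ha hu j ?_).trans (by gcongr)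
    rw [mul_one_div]
    exact hut.trans_eq habs)
  obtain ⟨m₀, h₀⟩ := hfa
  obtain ⟨m₁, h₁⟩ := hfa'
  obtain ⟨m₂, h₂⟩ := exists_int_choose_mul_div n j hn
  obtain ⟨m, hm⟩ : ∃ m : ℤ, (n.choose j : ℝ) *
      (f a + derivWithin f (Set.Icc (0 : ℝ) 1) a * (t - a)) = m := by
    rw [h₀, h₁]
    rcases hta with h | h
    · exact ⟨n.choose j * m₀ + m₁ * m₂, by rw [h]; push_cast; rw [← h₂]; ring⟩
    · exact ⟨n.choose j * m₀ - m₁ * m₂, by rw [h]; push_cast; rw [← h₂]; ring⟩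
  refine (abs_sub_nint_le hnint _ m).trans ?_
  rw [← hm, show f t * (n.choose j : ℝ) - n.choose j *
      (f a + derivWithin f (Set.Icc (0 : ℝ) 1) a * (t - a)) = n.choose j *
      (f t - f a - derivWithin f (Set.Icc (0 : ℝ) 1) a * (t - a)) by ring, abs_mul, Nat.abs_cast]
  refine mul_le_mul_of_nonneg_left (hlin.trans ?_) (Nat.cast_nonneg _)
  rw [habs, div_pow]
  calc s * omega1 F (1 / n) * ((j : ℝ) ^ s / n ^ s)
      ≤ s * omega1 F (1 / n) * ((s : ℝ) ^ s / n ^ s) := by gcongr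
    _ = s ^ (s + 1) * omega1 F (1 / n) / n ^ s := by ring

/-- Theorem 2.3: simultaneous approximation of `B_n f` by the
nearest-integer Bernstein polynomial `B̂_n(f)`. -/
theorem deriv_bernstein_nearest_int_close (s : ℕ) (hs : 1 ≤ s) :
    ∃ c : ℝ, 0 < c ∧
      ∀ nint : ℝ → ℤ, (∀ a : ℝ, |a - (nint a : ℝ)| ≤ 1 / 2) →
      ∀ f : ℝ → ℝ,
      ContDiffOn ℝ s f (Set.Icc (0:ℝ) 1) →
      (∃ m : ℤ, f 0 = m) → (∃ m : ℤ, f 1 = m) →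
      (∃ m : ℤ, derivWithin f (Set.Icc (0:ℝ) 1) 0 = m) →
      (∃ m : ℤ, derivWithin f (Set.Icc (0:ℝ) 1) 1 = m) →
      (∀ i : ℕ, 2 ≤ i → i ≤ s → iteratedDerivWithin i f (Set.Icc (0:ℝ) 1) 0 = 0) →
      (∀ i : ℕ, 2 ≤ i → i ≤ s → iteratedDerivWithin i f (Set.Icc (0:ℝ) 1) 1 = 0) →
      ∀ n : ℕ, s ≤ n → ∀ x ∈ Set.Icc (0:ℝ) 1,
        |iteratedDeriv s (fun t : ℝ => ∑ k ∈ Finset.range (n + 1),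
              f ((k : ℝ) / n) * (n.choose k : ℝ) * t ^ k * (1 - t) ^ (n - k)) x
          - iteratedDeriv s (fun t : ℝ => ∑ k ∈ Finset.range (n + 1),
              (nint (f ((k : ℝ) / n) * (n.choose k : ℝ)) : ℝ) * t ^ k * (1 - t) ^ (n - k)) x|
          ≤ c * (omega1 (iteratedDerivWithin s f (Set.Icc (0:ℝ) 1)) (1 / n) + 1 / n) := by
  set A : ℝ := s ^ (s + 1) + 2 ^ s * (s + 1).factorial with hA
  have hA0 : 0 < A := by positivity
  refine ⟨2 ^ s * A, by positivity, ?_⟩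
  intro nint hnint f hf hf0 hf1 hd0 hd1 hz0 hz1 n hsn x hx
  set ω := omega1 (iteratedDerivWithin s f (Set.Icc (0:ℝ) 1)) (1 / n) with hωdef
  have hω : 0 ≤ ω := omega1_nonneg _ _
  have hn : 0 < n := by omega
  have hn' : (0 : ℝ) < n := by exact_mod_cast hn
  have hchoose : ∀ k ≤ n, (0 : ℝ) < n.choose k := fun k hk => by
    exact_mod_cast Nat.choose_pos hk
  have hnear : (s : ℝ) ^ (s + 1) * ω / n ^ s ≤ A * (ω + 1 / n) / n ^ s := by
    gcongr
    · rw [hA]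
      exact le_add_of_nonneg_right (by positivity)
    · exact le_add_of_nonneg_right (by positivity)
  have hround : ∀ k ≤ n, |f ((k : ℝ) / n) * n.choose k - nint (f ((k : ℝ) / n) * n.choose k)| ≤
      n.choose k * (A * (ω + 1 / n) / n ^ s) := by
    intro k hk
    have hkn : (k : ℝ) / n ∈ Set.Icc (0 : ℝ) 1 :=
      ⟨by positivity, (div_le_one hn').2 (by exact_mod_cast hk)⟩
    by_cases hks : k ≤ s
    · refine (abs_round_sub_le_near_endpoint hs hnint hf (Set.left_mem_Icc.2 zero_le_one) hkn
        hf0 hd0 hz0 hn hks (Or.inl (sub_zero _))).trans ?_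
      gcongr
    by_cases hks' : n - k ≤ s
    · have h := abs_round_sub_le_near_endpoint hs hnint hf (Set.right_mem_Icc.2 zero_le_one) hkn
        hf1 hd1 hz1 hn hks' (Or.inr (by rw [Nat.cast_sub hk]; field_simp; ring))
      rw [Nat.choose_symm hk] at h
      refine h.trans ?_
      gcongr
    refine (hnint _).trans ?_
    have h := inv_choose_le (not_le.1 hks) (not_le.1 hks')
    rw [div_le_iff₀ (hchoose k hk)] at h
    calc (1 : ℝ) / 2 ≤ 1 / 2 * (2 ^ (s + 1) * (s + 1).factorial / (n : ℝ) ^ (s + 1) *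
          n.choose k) := by linarith
      _ = n.choose k * (2 ^ s * (s + 1).factorial * (1 / n) / n ^ s) := by
        field_simp
        ring
      _ ≤ n.choose k * (A * (ω + 1 / n) / n ^ s) := by
        gcongr
        · rw [hA]
          exact le_add_of_nonneg_left (by positivity)
        · exact le_add_of_nonneg_left hω
  have hB : (fun t : ℝ => ∑ k ∈ Finset.range (n + 1),
      f ((k : ℝ) / n) * (n.choose k : ℝ) * t ^ k * (1 - t) ^ (n - k)) =
      fun t => (bernsteinSum n (fun k => f ((k : ℝ) / n))).eval t := by
    ext t
    rw [eval_bernsteinSum]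
  have hB' : (fun t : ℝ => ∑ k ∈ Finset.range (n + 1),
      (nint (f ((k : ℝ) / n) * (n.choose k : ℝ)) : ℝ) * t ^ k * (1 - t) ^ (n - k)) =
      fun t => (bernsteinSum n
        (fun k => nint (f ((k : ℝ) / n) * (n.choose k : ℝ)) / n.choose k)).eval t := by
    ext t
    rw [eval_bernsteinSum]
    refine sum_congr rfl fun k hk => ?_
    rw [div_mul_cancel₀ _ (hchoose k (mem_range_succ_iff.1 hk)).ne']
  rw [hB, hB', Polynomial.iteratedDeriv_eval, Polynomial.iteratedDeriv_eval,
    ← Polynomial.eval_sub, ← Polynomial.iterate_derivative_sub, bernsteinSum_sub]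
  refine (abs_eval_iterate_derivative_bernsteinSum_le s (M := A * (ω + 1 / n) / n ^ s)
    (fun k hk => ?_) hx).trans_eq ?_
  · have hc := hchoose k hk
    rw [sub_div' hc.ne', abs_div, abs_of_pos hc, div_le_iff₀' hc]
    exact hround k hk
  · rw [mul_pow]
    field_simp
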